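/- arXiv:2310.13081 — 3 statements merged into one kernel-verified Lean document; each statement's English description precedes it below -/
import Mathlib

section
/- (Transfer of the resolvent metastability condition to the joint hidden-Markov process; resolvent form of the paper's main theorem.) Let S be a finite nonempty set and X a countable nonempty set. For each N ∈ ℕ let H_N be a countable set with jump rates R_N : H_N × H_N → ℝ satisfying R_N(η,ξ) ≥ 0 and Σ_ξ R_N(η,ξ) < ∞ for every η, and let L_N be the associated Markov generator. Let (𝓔_N^s)_{s∈S} be pairwise disjoint subsets of H_N, set 𝓔_N = ∪_{s∈S} 𝓔_N^s and Δ_N = H_N \ 𝓔_N. Let 𝓛 be the generator on S defined from rates r : S × S → ℝ≥0. Assume condition R_𝓛: for every λ > 0 and every g : S → ℝ there is a unique bounded solution F_N of (λ − L_N)F_N = G_N, where G_N(η) = Σ_{s∈S} g(s)·1_{𝓔_N^s}(η); this solution satisfies sup_η |F_N(η)| ≤ (max_s |g(s)|)/λ; and for each s ∈ S, lim_{N→∞} sup_{η∈𝓔_N^s} |F_N(η) − f(s)| = 0, where f : S → ℝ is the unique solution of (λ − 𝓛)f = g. Let γ_N : H_N × X → ℝ≥0 satisfy sup_η Σ_{y∈X}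 γ_N(η,y) < ∞ for each N, and let γ : S × X → ℝ≥0 satisfy Σ_{y∈X} γ(s,y) < ∞ for each s. Assume (i) for each s ∈ S, lim_{N→∞} sup_{η∈𝓔_N^s} Σ_{y∈X} |γ_N(η,y) − γ(s,y)| = 0, and (ii) lim_{N→∞} sup_{η∈Δ_N} Σ_{y∈X} γ_N(η,y) = 0. Define the generator L_{Z_N} on H_N × X by (L_{Z_N}𝓕)(η,x) = (L_N 𝓕(·,x))(η) + Σ_{y∈X} γ_N(η,y)·[𝓕(η,y) − 𝓕(η,x)], and the generator 𝓛_Z on S × X by (𝓛_Z 𝔣)(s,x) = (𝓛 𝔣(·,x))(s) + Σ_{y∈X} γ(s,y)·[𝔣(s,y) − 𝔣(s,x)]. Then condition R_{𝓛_Z} holds for the wells 𝓔_N^s × {x}: for every λ > 0 and every bounded 𝔤 : S × X → ℝ, if 𝔣 is a bounded solution of (λ − 𝓛_Z)𝔣 = 𝔤 and, for each N, 𝓕_N is a bounded solution of (λ − L_{Z_N})𝓕_N = 𝓖_N with 𝓖_N(η,x) = Σ_{s∈S} 𝔤(s,x)·1_{𝓔_N^s}(η) satisfying sup_{(η,x)}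 |𝓕_N(η,x)| ≤ (sup_{(η,x)} |𝓖_N(η,x)|)/λ, then for every s ∈ S, lim_{N→∞} sup_{x∈X} sup_{η∈𝓔_N^s} |𝓕_N(η,x) − 𝔣(s,x)| = 0. -/
open Filter Topology

/-- The Markov generator associated to jump rates `R` on a countable state space:
`(L F)(η) = Σ'_ξ R(η,ξ)·[F(ξ) − F(η)]`. -/
noncomputable def jumpGen {E : Type*} (R : E → E → ℝ) (F : E → ℝ) (η : E) : ℝ :=
  ∑' ξ, R η ξ * (F ξ - F η)

/-- The Markov generator on a finite state space `S` with rates `r`: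
`(𝓛 f)(s) = Σ_t r(s,t)·[f(t) − f(s)]`. -/
noncomputable def finGen {S : Type*} [Fintype S] (r : S → S → ℝ) (f : S → ℝ) (s : S) : ℝ :=
  ∑ t, r s t * (f t - f s)

theorem summable_mul_of_abs_le {ι : Type*} {k F : ι → ℝ} {C : ℝ} (hk : Summable k)
    (hF : ∀ i, |F i| ≤ C) : Summable fun i => k i * F i := by
  refine Summable.of_norm_bounded (hk.abs.mul_right C) fun i => ?_
  rw [Real.norm_eq_abs, abs_mul]
  exact mul_le_mul_of_nonneg_left (hF i) (abs_nonneg _)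

theorem abs_tsum_mul_le {ι : Type*} {k F : ι → ℝ} {C : ℝ} (hk : Summable k)
    (hF : ∀ i, |F i| ≤ C) : |∑' i, k i * F i| ≤ (∑' i, |k i|) * C := by
  rw [← tsum_mul_right, ← Real.norm_eq_abs]
  refine tsum_of_norm_bounded (hk.abs.mul_right C).hasSum fun i => ?_
  rw [Real.norm_eq_abs, abs_mul]
  exact mul_le_mul_of_nonneg_left (hF i) (abs_nonneg _)

theorem tsum_mul_sub_const {ι : Type*} {k F : ι → ℝ} {C : ℝ} (hk : Summable k)
    (hF : ∀ i, |F i| ≤ C) (c : ℝ) :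
    ∑' i, k i * (F i - c) = ∑' i, k i * F i - (∑' i, k i) * c := by
  simp_rw [mul_sub]
  rw [(summable_mul_of_abs_le hk hF).tsum_sub (hk.mul_right c), tsum_mul_right]

theorem jumpGen_eq {E : Type*} {R : E → E → ℝ} {F : E → ℝ} {C : ℝ} {η : E}
    (hR : Summable (R η)) (hF : ∀ ξ, |F ξ| ≤ C) :
    jumpGen R F η = ∑' ξ, R η ξ * F ξ - (∑' ξ, R η ξ) * F η :=
  tsum_mul_sub_const hR hF _

theorem jumpGen_finset_sum {E S : Type*} [Fintype S] {R : E → E → ℝ} {F : S → E → ℝ} {C : S → ℝ}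
    {η : E} (hR : Summable (R η)) (hF : ∀ s ξ, |F s ξ| ≤ C s) (c : S → ℝ) :
    jumpGen R (fun ξ => ∑ s, c s * F s ξ) η = ∑ s, c s * jumpGen R (F s) η := by
  unfold jumpGen
  simp_rw [← tsum_mul_left]
  rw [← Summable.tsum_finsetSum]
  · refine tsum_congr fun ξ => ?_
    rw [← Finset.sum_sub_distrib, Finset.mul_sum]
    exact Finset.sum_congr rfl fun s _ => by ring
  · intro s _
    refine (summable_mul_of_abs_le (C := C s + C s) hR fun ξ => ?_).mul_left _
    exact (abs_sub _ _).trans (add_le_add (hF s ξ) (hF s η))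

theorem finGen_finset_sum {S : Type*} [Fintype S] (r : S → S → ℝ) (F : S → S → ℝ) (c : S → ℝ)
    (s : S) : finGen r (fun t => ∑ i, c i * F i t) s = ∑ i, c i * finGen r (F i) s := by
  unfold finGen
  simp_rw [← Finset.sum_sub_distrib, Finset.mul_sum]
  rw [Finset.sum_comm]
  exact Finset.sum_congr rfl fun i _ => Finset.sum_congr rfl fun t _ => by ring

/-- Between a nonnegative bounded subsolution of `(lam - L) v = 0` and a constant above it there
lies a solution (the largest subsolution below the constant). -/
theorem exists_solution_ge_of_subsolution {E : Type*} {R : E → E → ℝ} (hR0 : ∀ η ξ, 0 ≤ R η ξ)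
    (hRsum : ∀ η, Summable (R η)) {lam : ℝ} (hlam : 0 < lam) {p : E → ℝ} {M : ℝ}
    (hp0 : ∀ η, 0 ≤ p η) (hpM : ∀ η, p η ≤ M)
    (hp : ∀ η, (lam + ∑' ξ, R η ξ) * p η ≤ ∑' ξ, R η ξ * p ξ) :
    ∃ v : E → ℝ, (∀ η, p η ≤ v η) ∧ (∀ η, |v η| ≤ M) ∧
      ∀ η, lam * v η - jumpGen R v η = 0 := by
  let A : Set (E → ℝ) := {w | (∀ η, 0 ≤ w η) ∧ (∀ η, w η ≤ M) ∧
    ∀ η, (lam + ∑' ξ, R η ξ) * w η ≤ ∑' ξ, R η ξ * w ξ}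
  have hpA : p ∈ A := ⟨hp0, hpM, hp⟩
  have : Nonempty A := ⟨⟨p, hpA⟩⟩
  have hbdd : ∀ η, BddAbove (Set.range fun w : A => w.1 η) := fun η =>
    ⟨M, by rintro _ ⟨w, rfl⟩; exact w.2.2.1 η⟩
  let v : E → ℝ := fun η => ⨆ w : A, w.1 η
  have hle : ∀ w ∈ A, ∀ η, w η ≤ v η := fun w hw η => le_ciSup (hbdd η) ⟨w, hw⟩
  have hv0 : ∀ η, 0 ≤ v η := fun η => (hp0 η).trans (hle p hpA η)
  have hvM : ∀ η, v η ≤ M := fun η => ciSup_le fun w => w.2.2.1 η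
  have habs : ∀ {w : E → ℝ}, (∀ η, 0 ≤ w η) → (∀ η, w η ≤ M) → ∀ η, |w η| ≤ M :=
    fun h0 hM η => by rw [abs_of_nonneg (h0 η)]; exact hM η
  have hmono : ∀ {w w' : E → ℝ}, (∀ η, 0 ≤ w η) → (∀ η, w η ≤ M) → (∀ η, 0 ≤ w' η) →
      (∀ η, w' η ≤ M) → (∀ η, w η ≤ w' η) → ∀ η, ∑' ξ, R η ξ * w ξ ≤ ∑' ξ, R η ξ * w' ξ :=
    fun h0 hM h0' hM' h η => (summable_mul_of_abs_le (hRsum η) (habs h0 hM)).tsum_le_tsum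
      (fun ξ => mul_le_mul_of_nonneg_left (h ξ) (hR0 η ξ))
      (summable_mul_of_abs_le (hRsum η) (habs h0' hM'))
  have hq : ∀ η, 0 < lam + ∑' ξ, R η ξ := fun η => by
    have : 0 ≤ ∑' ξ, R η ξ := tsum_nonneg (hR0 η)
    linarith
  let T : E → ℝ := fun η => (∑' ξ, R η ξ * v ξ) / (lam + ∑' ξ, R η ξ)
  have hvT : ∀ η, v η ≤ T η := fun η => ciSup_le fun w => by
    rw [le_div_iff₀ (hq η), mul_comm]
    exact (w.2.2.2 η).trans (hmono w.2.1 w.2.2.1 hv0 hvM (hle w.1 w.2) η)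
  have hT0 : ∀ η, 0 ≤ T η := fun η => (hv0 η).trans (hvT η)
  have hTM : ∀ η, T η ≤ M := fun η => by
    rw [div_le_iff₀ (hq η)]
    have h1 := (le_abs_self _).trans (abs_tsum_mul_le (hRsum η) (habs hv0 hvM))
    simp_rw [abs_of_nonneg (hR0 η _)] at h1
    have h2 : 0 ≤ M := (hv0 η).trans (hvM η)
    nlinarith [mul_nonneg hlam.le h2]
  have hTA : T ∈ A := ⟨hT0, hTM, fun η => by
    rw [mul_div_cancel₀ _ (hq η).ne']
    exact hmono hv0 hvM hT0 hTM hvT η⟩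
  refine ⟨v, hle p hpA, habs hv0 hvM, fun η => ?_⟩
  have h : v η = T η := le_antisymm (hvT η) (hle T hTA η)
  rw [eq_div_iff (hq η).ne'] at h
  rw [jumpGen_eq (hRsum η) (habs hv0 hvM)]
  linarith

/-- Maximum principle for a generator whose homogeneous resolvent equation has no nontrivial
bounded solution. -/
theorem le_div_of_subsolution {E : Type*} {R : E → E → ℝ} (hR0 : ∀ η ξ, 0 ≤ R η ξ)
    (hRsum : ∀ η, Summable (R η)) {lam : ℝ} (hlam : 0 < lam)
    (huniq : ∀ v : E → ℝ, (∃ C : ℝ, ∀ η, |v η| ≤ C) →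
      (∀ η, lam * v η - jumpGen R v η = 0) → ∀ η, v η = 0)
    {u : E → ℝ} {C e : ℝ} (huC : ∀ η, |u η| ≤ C)
    (hu : ∀ η, (lam + ∑' ξ, R η ξ) * u η ≤ ∑' ξ, R η ξ * u ξ + e) (η : E) :
    u η ≤ e / lam := by
  let p : E → ℝ := fun η => max (u η - e / lam) 0
  have hp0 : ∀ η, 0 ≤ p η := fun η => le_max_right _ _
  have hpM : ∀ η, p η ≤ C + |e / lam| := fun η =>
    max_le (by linarith [(abs_le.1 (huC η)).2, neg_abs_le (e / lam)])
      (by linarith [(abs_nonneg _).trans (huC η), abs_nonneg (e / lam)])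
  have hpa : ∀ η, |p η| ≤ C + |e / lam| := fun η => by
    rw [abs_of_nonneg (hp0 η)]; exact hpM η
  have hp : ∀ η, (lam + ∑' ξ, R η ξ) * p η ≤ ∑' ξ, R η ξ * p ξ := fun η => by
    rcases le_total (u η - e / lam) 0 with h | h
    · rw [show p η = 0 from max_eq_right h, mul_zero]
      exact tsum_nonneg fun ξ => mul_nonneg (hR0 η ξ) (hp0 ξ)
    · rw [show p η = u η - e / lam from max_eq_left h]
      have h1 : ∑' ξ, R η ξ * (u ξ - e / lam) ≤ ∑' ξ, R η ξ * p ξ := by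
        refine Summable.tsum_le_tsum
          (fun ξ => mul_le_mul_of_nonneg_left (le_max_left _ _) (hR0 η ξ))
          (summable_mul_of_abs_le (C := C + |e / lam|) (hRsum η) fun ξ => ?_)
          (summable_mul_of_abs_le (hRsum η) hpa)
        exact (abs_sub _ _).trans (by linarith [huC ξ])
      rw [tsum_mul_sub_const (hRsum η) huC] at h1
      have h2 : lam * (e / lam) = e := mul_div_cancel₀ _ hlam.ne'
      linarith [hu η]
  obtain ⟨v, hpv, hvb, hv⟩ := exists_solution_ge_of_subsolution hR0 hRsum hlam hp0 hpM hp
  have h1 := hpv η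
  rw [huniq v ⟨_, hvb⟩ hv η] at h1
  linarith [le_max_left (u η - e / lam) 0]

/-- The resolvent of the joint generator is bounded by `1 / lam`, whenever the homogeneous
resolvent equation of the first coordinate has no nontrivial bounded solution. -/
theorem abs_le_div_of_joint_resolvent {E X : Type*} [Nonempty X] {R : E → E → ℝ}
    (hR0 : ∀ η ξ, 0 ≤ R η ξ) (hRsum : ∀ η, Summable (R η)) {lam : ℝ} (hlam : 0 < lam)
    (huniq : ∀ v : E → ℝ, (∃ C : ℝ, ∀ η, |v η| ≤ C) →
      (∀ η, lam * v η - jumpGen R v η = 0) → ∀ η, v η = 0)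
    {k : E → X → ℝ} (hk0 : ∀ η y, 0 ≤ k η y) (hk : ∀ η, Summable (k η))
    {W : E → X → ℝ} {C e : ℝ} (hWC : ∀ η x, |W η x| ≤ C)
    (hW : ∀ η x, |lam * W η x - (jumpGen R (fun ξ => W ξ x) η
      + ∑' y, k η y * (W η y - W η x))| ≤ e) (η : E) (x : X) :
    |W η x| ≤ e / lam := by
  let u : E → ℝ := fun η => ⨆ x, |W η x|
  have hbdd : ∀ η, BddAbove (Set.range fun x => |W η x|) := fun η =>
    ⟨C, by rintro _ ⟨x, rfl⟩; exact hWC η x⟩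
  have hle : ∀ η x, |W η x| ≤ u η := fun η x => le_ciSup (hbdd η) x
  have huC : ∀ η, |u η| ≤ C := fun η => by
    rw [abs_of_nonneg ((abs_nonneg _).trans (hle η x))]
    exact ciSup_le (hWC η)
  refine (hle η x).trans (le_div_of_subsolution hR0 hRsum hlam huniq huC (fun η => ?_) η)
  have hRη : 0 ≤ ∑' ξ, R η ξ := tsum_nonneg (hR0 η)
  have hkη : 0 ≤ ∑' y, k η y := tsum_nonneg (hk0 η)
  have key : ∀ x, (lam + ∑' ξ, R η ξ + ∑' y, k η y) * |W η x|
      ≤ ∑' ξ, R η ξ * u ξ + (∑' y, k η y) * u η + e := fun x => by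
    have h1 := hW η x
    rw [jumpGen_eq (hRsum η) fun ξ => hWC ξ x, tsum_mul_sub_const (hk η) (hWC η)] at h1
    have h2 : |∑' ξ, R η ξ * W ξ x| ≤ ∑' ξ, R η ξ * u ξ := by
      rw [← Real.norm_eq_abs]
      refine tsum_of_norm_bounded (summable_mul_of_abs_le (hRsum η) huC).hasSum fun ξ => ?_
      rw [Real.norm_eq_abs, abs_mul, abs_of_nonneg (hR0 η ξ)]
      exact mul_le_mul_of_nonneg_left (hle ξ x) (hR0 η ξ)
    have h3 := abs_tsum_mul_le (hk η) (hle η)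
    simp_rw [abs_of_nonneg (hk0 η _)] at h3
    have h4 : 0 ≤ lam + ∑' ξ, R η ξ + ∑' y, k η y := by linarith
    rw [← abs_of_nonneg h4, ← abs_mul]
    rw [abs_le] at h1 h2 h3 ⊢
    constructor <;> linarith [h1.1, h1.2, h2.1, h2.2, h3.1, h3.2]
  have hpos : 0 < lam + ∑' ξ, R η ξ + ∑' y, k η y := by linarith
  have h := ciSup_le fun x => (le_div_iff₀' hpos).2 (key x)
  rw [le_div_iff₀' hpos] at h
  change _ * u η ≤ _ at h
  linarith

/-- Close functions and close kernels have close jump terms. -/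
theorem abs_tsum_mul_sub_sub_le {X : Type*} {k k' F f : X → ℝ} {B d : ℝ} (hk : Summable k)
    (hk' : Summable k') (hk0 : ∀ y, 0 ≤ k' y) (hF : ∀ y, |F y| ≤ B) (hFf : ∀ y, |F y - f y| ≤ d)
    (x : X) :
    |∑' y, k y * (F y - F x) - ∑' y, k' y * (f y - f x)|
      ≤ (∑' y, |k y - k' y|) * (2 * B) + (∑' y, k' y) * (2 * d) := by
  have h1 : ∀ y, |F y - F x| ≤ 2 * B := fun y =>
    (abs_sub _ _).trans (by linarith [hF x, hF y])
  have h2 : ∀ y, |(F y - F x) - (f y - f x)| ≤ 2 * d := fun y => by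
    have hx := abs_le.1 (hFf x)
    have hy := abs_le.1 (hFf y)
    rw [abs_le]
    constructor <;> linarith [hx.1, hx.2, hy.1, hy.2]
  have h3 : ∀ y, |f y - f x| ≤ 2 * B + 2 * d := fun y => by
    have ha := abs_le.1 (h1 y)
    have hb := abs_le.1 (h2 y)
    rw [abs_le]
    constructor <;> linarith [ha.1, ha.2, hb.1, hb.2]
  have e1 := abs_tsum_mul_le (hk.sub hk') h1
  have e2 := abs_tsum_mul_le hk' h2
  simp_rw [abs_of_nonneg (hk0 _)] at e2
  have heq : ∑' y, k y * (F y - F x) - ∑' y, k' y * (f y - f x)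
      = ∑' y, (k y - k' y) * (F y - F x) + ∑' y, k' y * ((F y - F x) - (f y - f x)) := by
    rw [← (summable_mul_of_abs_le hk h1).tsum_sub (summable_mul_of_abs_le hk' h3),
      ← (summable_mul_of_abs_le (hk.sub hk') h1).tsum_add (summable_mul_of_abs_le hk' h2)]
    exact tsum_congr fun y => by ring
  rw [heq]
  exact (abs_add_le _ _).trans (add_le_add e1 e2)

theorem sum_indicator_eq {E S : Type*} [Fintype S] {A : S → Set E}
    (hA : ∀ s t, s ≠ t → Disjoint (A s) (A t)) (g : S → ℝ) {s : S} {η : E} (hη : η ∈ A s) :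
    ∑ t, Set.indicator (A t) (fun _ => g t) η = g s := by
  rw [Finset.sum_eq_single s, Set.indicator_of_mem hη]
  · intro t _ hts
    exact Set.indicator_of_notMem (fun h => Set.disjoint_left.1 (hA t s hts) h hη) _
  · simp

theorem sum_indicator_eq_zero {E S : Type*} [Fintype S] {A : S → Set E} (g : S → ℝ) {η : E}
    (hη : ∀ s, η ∉ A s) : ∑ t, Set.indicator (A t) (fun _ => g t) η = 0 :=
  Finset.sum_eq_zero fun t _ => Set.indicator_of_notMem (hη t) _

/-- Transfer of the resolvent metastability condition of Landim–Marcondes–Seo from the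
market process `ξ_N(·)` (generator `L_N`, wells `𝓔_N^s`) to the joint hidden-Markov
process `Z_N(·) = (ξ_N(·), X_N(·))` (generator `L_{Z_N}`, wells `𝓔_N^s × {x}`):
the resolvent form of the paper's main theorem. -/
theorem resolvent_condition_transfer
    (S : Type*) [Fintype S] [Nonempty S]
    (X : Type*) [Countable X] [Nonempty X]
    (H : ℕ → Type*) [∀ N, Countable (H N)]
    -- jump rates of the market process
    (R : ∀ N, H N → H N → ℝ)
    (hR0 : ∀ N η ξ, 0 ≤ R N η ξ)
    (hRsum : ∀ N η, Summable (R N η))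
    -- pairwise disjoint metastable wells
    (𝓔 : ∀ N, S → Set (H N))
    (hdisj : ∀ N, ∀ s t : S, s ≠ t → Disjoint (𝓔 N s) (𝓔 N t))
    -- rates of the reduced chain on the macrostates
    (r : S → S → ℝ) (hr : ∀ s t, 0 ≤ r s t)
    -- condition R_𝓛: the reduced resolvent equation has a unique solution f, ...
    (hRL₁ : ∀ lam : ℝ, 0 < lam → ∀ g : S → ℝ,
      ∃! f : S → ℝ, ∀ s, lam * f s - finGen r f s = g s)
    -- ... and the resolvent equation (λ − L_N)F_N = G_N has a unique bounded solution
    -- F_N, with sup_η |F_N(η)| ≤ (max_s |g(s)|)/λ, which is asymptotically constant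
    -- on each well 𝓔_N^s with limiting value f(s).
    (hRL₂ : ∀ lam : ℝ, 0 < lam → ∀ g : S → ℝ, ∀ f : S → ℝ,
      (∀ s, lam * f s - finGen r f s = g s) →
      ∃ F : ∀ N, H N → ℝ,
        (∀ N,
          (∃ C : ℝ, ∀ η, |F N η| ≤ C) ∧
          (∀ η, lam * F N η - jumpGen (R N) (F N) η
              = ∑ s : S, Set.indicator (𝓔 N s) (fun _ => g s) η) ∧
          (∀ F' : H N → ℝ, (∃ C : ℝ, ∀ η, |F' η| ≤ C) →
            (∀ η, lam * F' η - jumpGen (R N) F' η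
                = ∑ s : S, Set.indicator (𝓔 N s) (fun _ => g s) η) → F' = F N) ∧
          (∀ η, |F N η| ≤ (⨆ s, |g s|) / lam)) ∧
        (∀ s : S, ∀ ε > (0 : ℝ), ∃ N₀ : ℕ, ∀ N, N₀ ≤ N → ∀ η ∈ 𝓔 N s,
          |F N η - f s| < ε))
    -- jump rates of the observable coordinate
    (γN : ∀ N, H N → X → ℝ) (hγN0 : ∀ N η y, 0 ≤ γN N η y)
    (hγNsum : ∀ N, ∃ C : ℝ, ∀ η, Summable (γN N η) ∧ ∑' y, γN N η y ≤ C)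
    (γ : S → X → ℝ) (hγ0 : ∀ s y, 0 ≤ γ s y) (hγsum : ∀ s, Summable (γ s))
    -- (i): uniform convergence of γ_N to γ on each well
    (hγconv : ∀ s : S, ∀ ε > (0 : ℝ), ∃ N₀ : ℕ, ∀ N, N₀ ≤ N → ∀ η ∈ 𝓔 N s,
      ∑' y, |γN N η y - γ s y| < ε)
    -- (ii): uniform vanishing of γ_N on Δ_N
    (hγΔ : ∀ ε > (0 : ℝ), ∃ N₀ : ℕ, ∀ N, N₀ ≤ N → ∀ η : H N, (∀ s : S, η ∉ 𝓔 N s) →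
      ∑' y, γN N η y < ε) :
    -- conclusion: condition R_{𝓛_Z} holds for the wells 𝓔_N^s × {x}
    ∀ lam : ℝ, 0 < lam →
    ∀ 𝔤 : S → X → ℝ, (∃ C : ℝ, ∀ s x, |𝔤 s x| ≤ C) →
    ∀ 𝔣 : S → X → ℝ, (∃ C : ℝ, ∀ s x, |𝔣 s x| ≤ C) →
      -- 𝔣 is a bounded solution of (λ − 𝓛_Z)𝔣 = 𝔤
      (∀ s x, lam * 𝔣 s x - (finGen r (fun t => 𝔣 t x) s
          + ∑' y, γ s y * (𝔣 s y - 𝔣 s x)) = 𝔤 s x) →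
    ∀ 𝓕 : ∀ N, H N → X → ℝ,
      (∀ N,
        -- 𝓕_N is a bounded solution of (λ − L_{Z_N})𝓕_N = 𝓖_N
        (∃ C : ℝ, ∀ η x, |𝓕 N η x| ≤ C) ∧
        (∀ η x, lam * 𝓕 N η x - (jumpGen (R N) (fun η' => 𝓕 N η' x) η
            + ∑' y, γN N η y * (𝓕 N η y - 𝓕 N η x))
          = ∑ s : S, Set.indicator (𝓔 N s) (fun _ => 𝔤 s x) η) ∧
        -- satisfying sup |𝓕_N| ≤ sup |𝓖_N| / λ
        (∀ C : ℝ,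
          (∀ η x, |∑ s : S, Set.indicator (𝓔 N s) (fun _ => 𝔤 s x) η| ≤ C) →
          ∀ η x, |𝓕 N η x| ≤ C / lam)) →
    -- then 𝓕_N is asymptotically constant on each well 𝓔_N^s × {x}, with value 𝔣(s,x)
    ∀ s : S, ∀ ε > (0 : ℝ), ∃ N₀ : ℕ, ∀ N, N₀ ≤ N → ∀ x : X, ∀ η ∈ 𝓔 N s,
      |𝓕 N η x - 𝔣 s x| < ε := by
  classical
  intro lam hlam 𝔤 ⟨Cg, hCg⟩ 𝔣 ⟨Cf, hCf⟩ h𝔣 𝓕 h𝓕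
  have hkN : ∀ N η, Summable (γN N η) := fun N η => by
    obtain ⟨C, hC⟩ := hγNsum N
    exact (hC η).1
  -- bounded solutions of the homogeneous equation vanish
  have huniq : ∀ N (v : H N → ℝ), (∃ C : ℝ, ∀ η, |v η| ≤ C) →
      (∀ η, lam * v η - jumpGen (R N) v η = 0) → ∀ η, v η = 0 := by
    intro N v hv hv0 η
    obtain ⟨F, hF, -⟩ := hRL₂ lam hlam (fun _ => 0) (fun _ => 0) fun s => by simp [finGen]
    have h1 := (hF N).2.2.1 v hv fun η => by simp [hv0 η]
    have h2 := (hF N).2.2.2 η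
    rw [← h1] at h2
    simpa using h2
  choose φ hφ hφu using fun t : S => hRL₁ lam hlam (Pi.single t 1)
  choose F hF hFφ using fun t : S => hRL₂ lam hlam (Pi.single t 1) (φ t) (hφ t)
  let h : X → S → ℝ := fun x s => lam * 𝔣 s x - finGen r (fun t => 𝔣 t x) s
  have hh : ∀ x s, h x s = 𝔤 s x + ∑' y, γ s y * (𝔣 s y - 𝔣 s x) := fun x s => by
    linarith [h𝔣 s x]
  have h𝔣φ : ∀ x s, 𝔣 s x = ∑ t, h x t * φ t s := by
    intro x s
    refine congrFun ((hRL₁ lam hlam (h x)).unique (y₁ := fun s => 𝔣 s x)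
      (y₂ := fun s => ∑ t, h x t * φ t s) (fun _ => rfl) fun s => ?_) s
    rw [finGen_finset_sum, Finset.mul_sum, ← Finset.sum_sub_distrib]
    trans ∑ t, h x t * (Pi.single t 1 : S → ℝ) s
    · refine Finset.sum_congr rfl fun t _ => ?_
      rw [← hφ t s]
      ring
    · simp [Pi.single_apply]
  let K : ℝ := ∑ s, ∑' y, γ s y
  have hK0 : ∀ s, 0 ≤ ∑' y, γ s y := fun s => tsum_nonneg (hγ0 s)
  have hK : ∀ s, ∑' y, γ s y ≤ K := fun s =>
    Finset.single_le_sum (f := fun s => ∑' y, γ s y) (fun s _ => hK0 s) (Finset.mem_univ s)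
  have hKnn : 0 ≤ K := Finset.sum_nonneg fun s _ => hK0 s
  have x₀ := Classical.arbitrary X
  have s₀ := Classical.arbitrary S
  have hCg0 : 0 ≤ Cg := (abs_nonneg _).trans (hCg s₀ x₀)
  have hCf0 : 0 ≤ Cf := (abs_nonneg _).trans (hCf s₀ x₀)
  let Ch : ℝ := Cg + K * (2 * Cf)
  have hCh0 : 0 ≤ Ch := by positivity
  have hCh : ∀ x s, |h x s| ≤ Ch := fun x s => by
    rw [hh]
    have h1 := abs_tsum_mul_le (C := 2 * Cf) (hγsum s) (F := fun y => 𝔣 s y - 𝔣 s x)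
      fun y => (abs_sub _ _).trans (by linarith [hCf s x, hCf s y])
    simp_rw [abs_of_nonneg (hγ0 s _)] at h1
    refine (abs_add_le _ _).trans (add_le_add (hCg s x) (h1.trans ?_))
    exact mul_le_mul_of_nonneg_right (hK s) (by linarith)
  let D : S → ℝ := fun t => (⨆ s, |(Pi.single t 1 : S → ℝ) s|) / lam
  have hD : ∀ t N η, |F t N η| ≤ D t := fun t N η => (hF t N).2.2.2 η
  let G : ∀ N, H N → X → ℝ := fun N η x => ∑ t, h x t * F t N η
  have hD0 : ∀ t, 0 ≤ D t := fun t =>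
    div_nonneg (Real.iSup_nonneg fun s => abs_nonneg _) hlam.le
  let B : ℝ := ∑ t, Ch * D t
  have hB0 : 0 ≤ B := Finset.sum_nonneg fun t _ => mul_nonneg hCh0 (hD0 t)
  have hG : ∀ N η x, |G N η x| ≤ B := fun N η x =>
    (Finset.abs_sum_le_sum_abs _ _).trans <| Finset.sum_le_sum fun t _ => by
      rw [abs_mul]
      exact mul_le_mul (hCh x t) (hD t N η) (abs_nonneg _) hCh0
  have hGeq : ∀ N η x, lam * G N η x - jumpGen (R N) (fun ξ => G N ξ x) η
      = ∑ s, Set.indicator (𝓔 N s) (fun _ => h x s) η := by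
    intro N η x
    rw [jumpGen_finset_sum (hRsum N η) fun t ξ => hD t N ξ, Finset.mul_sum,
      ← Finset.sum_sub_distrib]
    refine Finset.sum_congr rfl fun t _ => ?_
    have h1 := (hF t N).2.1 η
    rw [Finset.sum_eq_single t (fun s _ hst => by simp [hst]) (by simp)] at h1
    trans h x t * (lam * F t N η - jumpGen (R N) (F t N) η)
    · ring
    · rw [h1]
      by_cases hη : η ∈ 𝓔 N t <;> simp [hη]
  intro s ε hε
  obtain ⟨a, ha, haε⟩ : ∃ a > 0, (a * (2 * B) + K * (2 * (∑ _t : S, Ch * a))) / lam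
      + ∑ _t : S, Ch * a < ε := by
    have hc : Continuous fun a : ℝ => (a * (2 * B) + K * (2 * (∑ _t : S, Ch * a))) / lam
      + ∑ _t : S, Ch * a := by fun_prop
    have h1 := (hc.tendsto 0).eventually_lt_const (u := ε) (by simpa using hε)
    obtain ⟨a, h2, h3⟩ := ((h1.filter_mono nhdsWithin_le_nhds).and
      (self_mem_nhdsWithin (s := Set.Ioi (0 : ℝ)))).exists
    exact ⟨a, h3, h2⟩
  set d : ℝ := ∑ _t : S, Ch * a with hd
  have hd0 : 0 ≤ d := Finset.sum_nonneg fun t _ => mul_nonneg hCh0 ha.le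
  have ev1 : ∀ᶠ N in atTop, ∀ t s, ∀ η ∈ 𝓔 N s, |F t N η - φ t s| < a := by
    rw [eventually_all]
    intro t
    rw [eventually_all]
    exact fun s => eventually_atTop.2 (hFφ t s a ha)
  have ev2 : ∀ᶠ N in atTop, ∀ s, ∀ η ∈ 𝓔 N s, ∑' y, |γN N η y - γ s y| < a := by
    rw [eventually_all]
    exact fun s => eventually_atTop.2 (hγconv s a ha)
  obtain ⟨N₀, hN₀⟩ := eventually_atTop.1
    ((ev1.and ev2).and (eventually_atTop.2 (hγΔ a ha)))
  refine ⟨N₀, fun N hN x η hη => ?_⟩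
  obtain ⟨⟨c1, c2⟩, c3⟩ := hN₀ N hN
  have hGf : ∀ s, ∀ η ∈ 𝓔 N s, ∀ x, |G N η x - 𝔣 s x| ≤ d := by
    intro s η hη x
    rw [h𝔣φ x s, ← Finset.sum_sub_distrib]
    refine (Finset.abs_sum_le_sum_abs _ _).trans (Finset.sum_le_sum fun t _ => ?_)
    rw [← mul_sub, abs_mul]
    exact mul_le_mul (hCh x t) (c1 t s η hη).le (abs_nonneg _) hCh0
  obtain ⟨⟨C, hC⟩, hFeq, -⟩ := h𝓕 N
  have hW := abs_le_div_of_joint_resolvent (hR0 N) (hRsum N) hlam (huniq N) (hγN0 N) (hkN N)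
    (W := fun η x => 𝓕 N η x - G N η x) (C := C + B) (e := a * (2 * B) + K * (2 * d))
    (fun η x => (abs_sub _ _).trans (add_le_add (hC η x) (hG N η x))) ?_ η x
  · have h1 := abs_le.1 hW
    have h2 := abs_le.1 (hGf s η hη x)
    rw [abs_lt]
    constructor <;> linarith [h1.1, h1.2, h2.1, h2.2]
  · intro η x
    have e1 := hFeq η x
    have e2 := hGeq N η x
    have hGx : ∀ y, |G N η y - G N η x| ≤ 2 * B := fun y =>
      (abs_sub _ _).trans (by linarith [hG N η x, hG N η y])
    rw [jumpGen_eq (hRsum N η) fun ξ => hC ξ x, tsum_mul_sub_const (hkN N η) (hC η)] at e1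
    rw [jumpGen_eq (hRsum N η) fun ξ => hG N ξ x] at e2
    have e3 := tsum_mul_sub_const (hkN N η) (hG N η) (G N η x)
    have hWb : ∀ ξ y, |𝓕 N ξ y - G N ξ y| ≤ C + B := fun ξ y =>
      (abs_sub _ _).trans (add_le_add (hC ξ y) (hG N ξ y))
    rw [jumpGen_eq (hRsum N η) fun ξ => hWb ξ x, tsum_mul_sub_const (hkN N η) (hWb η)]
    simp_rw [mul_sub]
    rw [(summable_mul_of_abs_le (hRsum N η) fun ξ => hC ξ x).tsum_sub
        (summable_mul_of_abs_le (hRsum N η) fun ξ => hG N ξ x),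
      (summable_mul_of_abs_le (hkN N η) (hC η)).tsum_sub
        (summable_mul_of_abs_le (hkN N η) (hG N η))]
    by_cases hη : ∃ s, η ∈ 𝓔 N s
    · obtain ⟨s, hη⟩ := hη
      rw [sum_indicator_eq (hdisj N) (fun s => 𝔤 s x) hη] at e1
      rw [sum_indicator_eq (hdisj N) (h x) hη, hh] at e2
      have h1 := abs_tsum_mul_sub_sub_le (hkN N η) (hγsum s) (hγ0 s) (hG N η) (hGf s η hη) x
      have h2 : (∑' y, |γN N η y - γ s y|) * (2 * B) ≤ a * (2 * B) :=
        mul_le_mul_of_nonneg_right (c2 s η hη).le (by linarith)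
      have h3 : (∑' y, γ s y) * (2 * d) ≤ K * (2 * d) :=
        mul_le_mul_of_nonneg_right (hK s) (by linarith)
      rw [e3] at h1
      rw [abs_le] at h1 ⊢
      constructor <;> linarith [h1.1, h1.2]
    · push Not at hη
      rw [sum_indicator_eq_zero (fun s => 𝔤 s x) hη] at e1
      rw [sum_indicator_eq_zero (h x) hη] at e2
      have h1 := abs_tsum_mul_le (hkN N η) hGx
      simp_rw [abs_of_nonneg (hγN0 N η _)] at h1
      have h2 : (∑' y, γN N η y) * (2 * B) ≤ a * (2 * B) :=
        mul_le_mul_of_nonneg_right (c3 η hη).le (by linarith)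
      have h3 : 0 ≤ K * (2 * d) := by positivity
      rw [e3] at h1
      rw [abs_le] at h1 ⊢
      constructor <;> linarith [h1.1, h1.2]
end

section
/- (Key estimate in the proof of the main theorem; the paper's display (solution_oN1).) In the setting of the transfer theorem (hypotheses listed in the context), fix λ > 0 and a bounded 𝔤 : S × X → ℝ, and let 𝔣 be a bounded solution of (λ − 𝓛_Z)𝔣 = 𝔤. For each x ∈ X let F_{N,x} be the unique bounded solution of (λ − L_N)F_{N,x} = G_{N,x}, where G_{N,x}(η) = Σ_{s∈S} [𝔤(s,x) + Σ_{y∈X} γ(s,y)·(𝔣(s,y) − 𝔣(s,x))]·1_{𝓔_N^s}(η), and set F_N(η,x) := F_{N,x}(η). Then lim_{N→∞} sup_{(η,x)∈H_N×X} | λ·F_N(η,x) − (L_{Z_N}F_N)(η,x) − 𝓖_N(η,x) | = 0, where 𝓖_N(η,x) = Σ_{s∈S} 𝔤(s,x)·1_{𝓔_N^s}(η). -/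
open Filter Topology

/-- A summable weight times a bounded function is summable. -/
lemma summable_mul_of_abs_le_s1 {Y : Type*} {a b : Y → ℝ} {B : ℝ}
    (ha : Summable a) (hb : ∀ y, |b y| ≤ B) : Summable fun y => a y * b y := by
  refine Summable.of_norm_bounded (ha.abs.mul_right B) fun y => ?_
  rw [Real.norm_eq_abs, abs_mul]
  exact mul_le_mul_of_nonneg_left (hb y) (abs_nonneg _)

lemma abs_tsum_mul_le_s1 {Y : Type*} {a b : Y → ℝ} {B : ℝ}
    (ha : Summable a) (hb : ∀ y, |b y| ≤ B) : |∑' y, a y * b y| ≤ (∑' y, |a y|) * B := by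
  rw [← tsum_mul_right, ← Real.norm_eq_abs]
  refine tsum_of_norm_bounded (ha.abs.mul_right B).hasSum fun y => ?_
  rw [Real.norm_eq_abs, abs_mul]
  exact mul_le_mul_of_nonneg_left (hb y) (abs_nonneg _)

lemma abs_sub_le_two_mul {a b B : ℝ} (ha : |a| ≤ B) (hb : |b| ≤ B) : |a - b| ≤ 2 * B :=
  (abs_sub a b).trans (by linarith)

lemma jumpGen_sum {ι E : Type*} [Fintype ι] {R : E → E → ℝ} {η : E} (hR : Summable (R η))
    (c : ι → ℝ) (U : ι → E → ℝ) (hU : ∀ i, ∃ C : ℝ, ∀ ξ, |U i ξ| ≤ C) :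
    jumpGen R (fun ξ => ∑ i, c i * U i ξ) η = ∑ i, c i * jumpGen R (U i) η := by
  have hsum : ∀ i, Summable fun ξ => c i * (R η ξ * (U i ξ - U i η)) := fun i => by
    obtain ⟨C, hC⟩ := hU i
    exact (summable_mul_of_abs_le_s1 hR fun ξ => abs_sub_le_two_mul (hC ξ) (hC η)).mul_left _
  simp only [jumpGen, ← tsum_mul_left]
  rw [← Summable.tsum_finsetSum fun i _ => hsum i]
  refine tsum_congr fun ξ => ?_
  rw [← Finset.sum_sub_distrib, Finset.mul_sum]
  exact Finset.sum_congr rfl fun i _ => by ring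

lemma finGen_sum {ι S : Type*} [Fintype ι] [Fintype S] (r : S → S → ℝ)
    (c : ι → ℝ) (u : ι → S → ℝ) (s : S) :
    finGen r (fun t => ∑ i, c i * u i t) s = ∑ i, c i * finGen r (u i) s := by
  simp only [finGen, Finset.mul_sum]
  rw [Finset.sum_comm]
  refine Finset.sum_congr rfl fun t _ => ?_
  rw [← Finset.sum_sub_distrib, Finset.mul_sum]
  exact Finset.sum_congr rfl fun i _ => by ring

lemma sum_indicator_eq_of_mem {S E : Type*} [Fintype S] {W : S → Set E}
    (hW : ∀ s t, s ≠ t → Disjoint (W s) (W t)) (g : S → ℝ) {s : S} {η : E} (hη : η ∈ W s) :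
    ∑ t, Set.indicator (W t) (fun _ => g t) η = g s := by
  rw [Finset.sum_eq_single s _ (by simp), Set.indicator_of_mem hη]
  exact fun t _ hts => Set.indicator_of_notMem
    (fun h => Set.disjoint_left.mp (hW t s hts) h hη) _

lemma sum_mul_sum_indicator_single {S E : Type*} [Fintype S] [DecidableEq S] (W : S → Set E)
    (c : S → ℝ) (η : E) :
    ∑ i, c i * ∑ s, Set.indicator (W s) (fun _ => (Pi.single i 1 : S → ℝ) s) η
      = ∑ s, Set.indicator (W s) (fun _ => c s) η := by
  simp only [Finset.mul_sum]
  rw [Finset.sum_comm]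
  refine Finset.sum_congr rfl fun s _ => ?_
  by_cases h : η ∈ W s <;> simp [h, Pi.single_apply]

/-- Under the resolvent condition, solutions of the resolvent equations converge on the wells
uniformly over all right-hand sides bounded by a constant `A`. -/
lemma resolvent_uniform_convergence {S : Type*} [Fintype S] {H : ℕ → Type*}
    {R : ∀ N, H N → H N → ℝ} (hRsum : ∀ N η, Summable (R N η))
    {W : ∀ N, S → Set (H N)} {r : S → S → ℝ} {lam : ℝ}
    (hred : ∀ g : S → ℝ, ∃! f : S → ℝ, ∀ s, lam * f s - finGen r f s = g s)
    (hres : ∀ g f : S → ℝ, (∀ s, lam * f s - finGen r f s = g s) →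
      ∃ F : ∀ N, H N → ℝ,
        (∀ N,
          (∃ C : ℝ, ∀ η, |F N η| ≤ C) ∧
          (∀ η, lam * F N η - jumpGen (R N) (F N) η
              = ∑ s : S, Set.indicator (W N s) (fun _ => g s) η) ∧
          (∀ F' : H N → ℝ, (∃ C : ℝ, ∀ η, |F' η| ≤ C) →
            (∀ η, lam * F' η - jumpGen (R N) F' η
                = ∑ s : S, Set.indicator (W N s) (fun _ => g s) η) → F' = F N) ∧
          (∀ η, |F N η| ≤ (⨆ s, |g s|) / lam)) ∧
        (∀ s : S, ∀ ε > (0 : ℝ), ∃ N₀ : ℕ, ∀ N, N₀ ≤ N → ∀ η ∈ W N s, |F N η - f s| < ε))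
    {A : ℝ} (hA : 0 ≤ A) {δ : ℝ} (hδ : 0 < δ) :
    ∃ N₀ : ℕ, ∀ N, N₀ ≤ N → ∀ g f : S → ℝ, (∀ s, |g s| ≤ A) →
      (∀ s, lam * f s - finGen r f s = g s) →
      ∀ F : H N → ℝ, (∃ C : ℝ, ∀ η, |F η| ≤ C) →
      (∀ η, lam * F η - jumpGen (R N) F η
        = ∑ s : S, Set.indicator (W N s) (fun _ => g s) η) →
      ∀ s, ∀ η ∈ W N s, |F η - f s| ≤ δ := by
  classical
  choose u hu _ using fun i : S => hred (Pi.single i 1)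
  choose U hU hUlim using fun i : S => hres (Pi.single i 1) (u i) (hu i)
  set κ : ℝ := δ / (A * Fintype.card S + 1) with hκ
  have hden : 0 < A * Fintype.card S + 1 := by positivity
  have hκ0 : 0 < κ := by positivity
  choose n hn using fun i s => hUlim i s κ hκ0
  refine ⟨Finset.univ.sup fun i => Finset.univ.sup fun s => n i s, fun N hN g f hg hf F hFb hF
    s η hη => ?_⟩
  have hnN : n ≤ fun _ _ => N := fun i s =>
    ((Finset.le_sup (f := fun s => n i s) (Finset.mem_univ s)).trans
      (Finset.le_sup (f := fun i => Finset.univ.sup fun s => n i s) (Finset.mem_univ i))).trans hN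
  have hfu : f = fun s => ∑ i, g i * u i s := by
    refine (hred g).unique hf fun s => ?_
    rw [finGen_sum, Finset.mul_sum, ← Finset.sum_sub_distrib,
      Finset.sum_congr rfl fun i _ => show lam * (g i * u i s) - g i * finGen r (u i) s
        = g i * (Pi.single i 1 : S → ℝ) s by rw [← hu i s]; ring]
    simp [Pi.single_apply]
  have hFU : F = fun ξ => ∑ i, g i * U i N ξ := by
    obtain ⟨V, hV, -⟩ := hres g f hf
    refine ((hV N).2.2.1 F hFb hF).trans ((hV N).2.2.1 _ ?_ fun ξ => ?_).symm
    · choose C hC using fun i => (hU i N).1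
      refine ⟨∑ i, |g i| * C i, fun ξ => (Finset.abs_sum_le_sum_abs _ _).trans
        (Finset.sum_le_sum fun i _ => ?_)⟩
      rw [abs_mul]
      exact mul_le_mul_of_nonneg_left (hC i ξ) (abs_nonneg _)
    · rw [jumpGen_sum (hRsum N ξ) _ _ fun i => (hU i N).1, Finset.mul_sum,
        ← Finset.sum_sub_distrib, ← sum_mul_sum_indicator_single]
      refine Finset.sum_congr rfl fun i _ => ?_
      rw [← (hU i N).2.1 ξ]
      ring
  rw [hfu, hFU, ← Finset.sum_sub_distrib]
  calc |∑ i, (g i * U i N η - g i * u i s)|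
      ≤ ∑ i, |g i * U i N η - g i * u i s| := Finset.abs_sum_le_sum_abs _ _
    _ ≤ ∑ _i : S, A * κ := Finset.sum_le_sum fun i _ => by
        rw [← mul_sub, abs_mul]
        exact mul_le_mul (hg i) (hn i s N (hnN i s) η hη).le (abs_nonneg _) hA
    _ = A * Fintype.card S * κ := by simp; ring
    _ ≤ (A * Fintype.card S + 1) * κ := by nlinarith
    _ = δ := mul_div_cancel₀ _ hden.ne'

/-- Key estimate in the proof of the paper's main theorem (display `(solution_oN1)`):
with `F_N(η,x) := F_{N,x}(η)` built from the unique bounded solutions `F_{N,x}` of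
`(λ − L_N)F_{N,x} = G_{N,x}`, one has
`lim_N sup_{(η,x)} |λ·F_N(η,x) − (L_{Z_N}F_N)(η,x) − 𝓖_N(η,x)| = 0`. -/
theorem key_estimate_solution_oN1
    (S : Type*) [Fintype S] [Nonempty S]
    (X : Type*) [Countable X] [Nonempty X]
    (H : ℕ → Type*) [∀ N, Countable (H N)]
    -- jump rates of the market process
    (R : ∀ N, H N → H N → ℝ)
    (hR0 : ∀ N η ξ, 0 ≤ R N η ξ)
    (hRsum : ∀ N η, Summable (R N η))
    -- pairwise disjoint metastable wells
    (𝓔 : ∀ N, S → Set (H N))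
    (hdisj : ∀ N, ∀ s t : S, s ≠ t → Disjoint (𝓔 N s) (𝓔 N t))
    -- rates of the reduced chain on the macrostates
    (r : S → S → ℝ) (hr : ∀ s t, 0 ≤ r s t)
    -- condition R_𝓛: the reduced resolvent equation has a unique solution f, ...
    (hRL₁ : ∀ lam : ℝ, 0 < lam → ∀ g : S → ℝ,
      ∃! f : S → ℝ, ∀ s, lam * f s - finGen r f s = g s)
    -- ... and the resolvent equation (λ − L_N)F_N = G_N has a unique bounded solution
    -- F_N, with sup_η |F_N(η)| ≤ (max_s |g(s)|)/λ, which is asymptotically constant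
    -- on each well 𝓔_N^s with limiting value f(s).
    (hRL₂ : ∀ lam : ℝ, 0 < lam → ∀ g : S → ℝ, ∀ f : S → ℝ,
      (∀ s, lam * f s - finGen r f s = g s) →
      ∃ F : ∀ N, H N → ℝ,
        (∀ N,
          (∃ C : ℝ, ∀ η, |F N η| ≤ C) ∧
          (∀ η, lam * F N η - jumpGen (R N) (F N) η
              = ∑ s : S, Set.indicator (𝓔 N s) (fun _ => g s) η) ∧
          (∀ F' : H N → ℝ, (∃ C : ℝ, ∀ η, |F' η| ≤ C) →
            (∀ η, lam * F' η - jumpGen (R N) F' η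
                = ∑ s : S, Set.indicator (𝓔 N s) (fun _ => g s) η) → F' = F N) ∧
          (∀ η, |F N η| ≤ (⨆ s, |g s|) / lam)) ∧
        (∀ s : S, ∀ ε > (0 : ℝ), ∃ N₀ : ℕ, ∀ N, N₀ ≤ N → ∀ η ∈ 𝓔 N s,
          |F N η - f s| < ε))
    -- jump rates of the observable coordinate
    (γN : ∀ N, H N → X → ℝ) (hγN0 : ∀ N η y, 0 ≤ γN N η y)
    (hγNsum : ∀ N, ∃ C : ℝ, ∀ η, Summable (γN N η) ∧ ∑' y, γN N η y ≤ C)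
    (γ : S → X → ℝ) (hγ0 : ∀ s y, 0 ≤ γ s y) (hγsum : ∀ s, Summable (γ s))
    -- (i): uniform convergence of γ_N to γ on each well
    (hγconv : ∀ s : S, ∀ ε > (0 : ℝ), ∃ N₀ : ℕ, ∀ N, N₀ ≤ N → ∀ η ∈ 𝓔 N s,
      ∑' y, |γN N η y - γ s y| < ε)
    -- (ii): uniform vanishing of γ_N on Δ_N
    (hγΔ : ∀ ε > (0 : ℝ), ∃ N₀ : ℕ, ∀ N, N₀ ≤ N → ∀ η : H N, (∀ s : S, η ∉ 𝓔 N s) →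
      ∑' y, γN N η y < ε)
    -- fix λ > 0, a bounded 𝔤, and a bounded solution 𝔣 of (λ − 𝓛_Z)𝔣 = 𝔤
    (lam : ℝ) (hlam : 0 < lam)
    (𝔤 : S → X → ℝ) (h𝔤 : ∃ C : ℝ, ∀ s x, |𝔤 s x| ≤ C)
    (𝔣 : S → X → ℝ) (h𝔣 : ∃ C : ℝ, ∀ s x, |𝔣 s x| ≤ C)
    (h𝔣eq : ∀ s x, lam * 𝔣 s x - (finGen r (fun t => 𝔣 t x) s
        + ∑' y, γ s y * (𝔣 s y - 𝔣 s x)) = 𝔤 s x)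
    -- F(N)(·,x) = F_{N,x} is the (unique) bounded solution of (λ − L_N)F_{N,x} = G_{N,x}
    (F : ∀ N, H N → X → ℝ)
    (hFbdd : ∀ N x, ∃ C : ℝ, ∀ η, |F N η x| ≤ C)
    (hFeq : ∀ N x η,
      lam * F N η x - jumpGen (R N) (fun η' => F N η' x) η
        = ∑ s : S, Set.indicator
            (𝓔 N s)
            (fun _ => 𝔤 s x + ∑' y, γ s y * (𝔣 s y - 𝔣 s x)) η) :
    -- conclusion: λ·F_N − L_{Z_N}F_N − 𝓖_N vanishes uniformly over H_N × X
    ∀ ε > (0 : ℝ), ∃ N₀ : ℕ, ∀ N, N₀ ≤ N → ∀ (η : H N) (x : X),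
      |lam * F N η x
        - (jumpGen (R N) (fun η' => F N η' x) η
            + ∑' y, γN N η y * (F N η y - F N η x))
        - ∑ s : S, Set.indicator (𝓔 N s) (fun _ => 𝔤 s x) η| < ε := by
  intro ε hε
  obtain ⟨Cg, hCg⟩ := h𝔤
  obtain ⟨Cf, hCf⟩ := h𝔣
  set G : S → X → ℝ := fun s x => 𝔤 s x + ∑' y, γ s y * (𝔣 s y - 𝔣 s x) with hG
  set Γ : ℝ := ∑ s, ∑' y, γ s y with hΓ
  have hΓs : ∀ s, ∑' y, γ s y ≤ Γ := fun s =>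
    Finset.single_le_sum (f := fun s => ∑' y, γ s y) (fun t _ => tsum_nonneg (hγ0 t))
      (Finset.mem_univ s)
  have hΓ0 : 0 ≤ Γ := Finset.sum_nonneg fun t _ => tsum_nonneg (hγ0 t)
  have hCf0 : 0 ≤ Cf := (abs_nonneg _).trans (hCf (Classical.arbitrary S) (Classical.arbitrary X))
  have hCg0 : 0 ≤ Cg := (abs_nonneg _).trans (hCg (Classical.arbitrary S) (Classical.arbitrary X))
  set A : ℝ := Cg + Γ * (2 * Cf) with hA
  have hA0 : 0 ≤ A := by positivity
  have hGA : ∀ s x, |G s x| ≤ A := fun s x => by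
    refine (abs_add_le _ _).trans (add_le_add (hCg s x) ?_)
    refine (abs_tsum_mul_le_s1 (hγsum s) fun y => abs_sub_le_two_mul (hCf s y) (hCf s x)).trans ?_
    simp only [abs_of_nonneg (hγ0 s _)]
    exact mul_le_mul_of_nonneg_right (hΓs s) (by positivity)
  have h𝔣G : ∀ x s, lam * 𝔣 s x - finGen r (fun t => 𝔣 t x) s = G s x := fun x s => by
    have := h𝔣eq s x
    simp only [hG]
    linarith
  set M : ℝ := A / lam with hM
  have hM0 : 0 ≤ M := by positivity
  have hFM : ∀ N η x, |F N η x| ≤ M := fun N η x => by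
    obtain ⟨V, hV, -⟩ := hRL₂ lam hlam (fun s => G s x) (fun s => 𝔣 s x) (h𝔣G x)
    have hFV : (fun ξ => F N ξ x) = V N := (hV N).2.2.1 _ (hFbdd N x) (hFeq N x)
    have hV' := (hV N).2.2.2 η
    rw [← hFV] at hV'
    exact hV'.trans (div_le_div_of_nonneg_right (ciSup_le fun s => hGA s x) hlam.le)
  have hsumN : ∀ N η, Summable (γN N η) := fun N η => ((hγNsum N).choose_spec η).1
  set κ : ℝ := ε / (4 * (M + 1)) with hκ
  have hκ0 : 0 < κ := by positivity
  have hκM : κ * (2 * M) < ε / 2 := by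
    rw [hκ, div_mul_eq_mul_div, div_lt_iff₀ (by positivity)]
    nlinarith
  set δ : ℝ := ε / (4 * (Γ + 1)) with hδ
  have hδ0 : 0 < δ := by positivity
  have hδΓ : Γ * (2 * δ) < ε / 2 := by
    rw [hδ, ← mul_div_assoc, ← mul_div_assoc, div_lt_iff₀ (by positivity)]
    nlinarith
  obtain ⟨N₁, hN₁⟩ := resolvent_uniform_convergence hRsum (hRL₁ lam hlam)
    (hRL₂ lam hlam) hA0 hδ0
  obtain ⟨N₂, hN₂⟩ := hγΔ κ hκ0
  choose n hn using fun s => hγconv s κ hκ0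
  refine ⟨max (max N₁ N₂) (Finset.univ.sup n), fun N hN η x => ?_⟩
  have hN1 : N₁ ≤ N := (le_max_left _ _).trans ((le_max_left _ _).trans hN)
  have hN2 : N₂ ≤ N := (le_max_right _ _).trans ((le_max_left _ _).trans hN)
  have hnN : ∀ s, n s ≤ N := fun s =>
    (Finset.le_sup (Finset.mem_univ s)).trans ((le_max_right _ _).trans hN)
  have hFdiff : ∀ y, |F N η y - F N η x| ≤ 2 * M := fun y =>
    abs_sub_le_two_mul (hFM N η y) (hFM N η x)
  rw [← sub_sub, hFeq N x η]
  by_cases hη : ∃ s, η ∈ 𝓔 N s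
  · obtain ⟨s, hs⟩ := hη
    rw [sum_indicator_eq_of_mem (hdisj N) (fun s => 𝔤 s x) hs,
      sum_indicator_eq_of_mem (hdisj N)
        (fun s => 𝔤 s x + ∑' y, γ s y * (𝔣 s y - 𝔣 s x)) hs]
    have hclose : ∀ y, |F N η y - 𝔣 s y| ≤ δ := fun y =>
      hN₁ N hN1 (fun s => G s y) (fun s => 𝔣 s y) (fun s => hGA s y) (h𝔣G y)
        (fun ξ => F N ξ y) (hFbdd N y) (hFeq N y) s η hs
    have hdiff : ∀ y, |(F N η y - 𝔣 s y) - (F N η x - 𝔣 s x)| ≤ 2 * δ := fun y =>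
      abs_sub_le_two_mul (hclose y) (hclose x)
    have hγd : Summable fun y => γN N η y - γ s y := (hsumN N η).sub (hγsum s)
    have hsplit : ∑' y, γN N η y * (F N η y - F N η x)
        = ∑' y, (γN N η y - γ s y) * (F N η y - F N η x)
          + ∑' y, γ s y * ((F N η y - 𝔣 s y) - (F N η x - 𝔣 s x))
          + ∑' y, γ s y * (𝔣 s y - 𝔣 s x) := by
      have h₁ := summable_mul_of_abs_le_s1 hγd hFdiff
      have h₂ := summable_mul_of_abs_le_s1 (hγsum s) hdiff
      have h₃ := summable_mul_of_abs_le_s1 (hγsum s) fun y =>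
        abs_sub_le_two_mul (hCf s y) (hCf s x)
      rw [← h₁.tsum_add h₂, ← (h₁.add h₂).tsum_add h₃]
      exact tsum_congr fun y => by ring
    have hb₁ : |∑' y, (γN N η y - γ s y) * (F N η y - F N η x)| < ε / 2 :=
      ((abs_tsum_mul_le_s1 hγd hFdiff).trans (mul_le_mul_of_nonneg_right
        (hn s N (hnN s) η hs).le (by positivity))).trans_lt hκM
    have hb₂ : |∑' y, γ s y * ((F N η y - 𝔣 s y) - (F N η x - 𝔣 s x))| < ε / 2 := by
      refine lt_of_le_of_lt ((abs_tsum_mul_le_s1 (hγsum s) hdiff).trans ?_) hδΓ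
      simp only [abs_of_nonneg (hγ0 s _)]
      exact mul_le_mul_of_nonneg_right (hΓs s) (by positivity)
    rw [hsplit]
    rw [abs_lt] at hb₁ hb₂ ⊢
    constructor <;> linarith
  · push Not at hη
    have hzero : ∀ g : S → ℝ, ∑ s, Set.indicator (𝓔 N s) (fun _ => g s) η = 0 := fun g =>
      Finset.sum_eq_zero fun s _ => Set.indicator_of_notMem (hη s) _
    rw [hzero fun s => 𝔤 s x, hzero fun s => 𝔤 s x + ∑' y, γ s y * (𝔣 s y - 𝔣 s x),
      zero_sub, sub_zero, abs_neg]
    refine lt_of_le_of_lt ((abs_tsum_mul_le_s1 (hsumN N η) hFdiff).trans ?_)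
      (hκM.trans (half_lt_self hε))
    simp only [abs_of_nonneg (hγN0 N η _)]
    exact mul_le_mul_of_nonneg_right (hN₂ N hN2 η hη).le (by positivity)
end

section
/- (Unique solvability of the reduced resolvent equation for the limiting hidden Markov model generator 𝓛_Z.) Let S be a finite nonempty set with generator 𝓛 defined from rates r : S × S → ℝ≥0, let X be a countable nonempty set, and let γ : S × X → ℝ≥0 satisfy sup_{s∈S} Σ_{y∈X} γ(s,y) < ∞. Let 𝓛_Z be the generator on S × X given by (𝓛_Z 𝔣)(s,x) = (𝓛 𝔣(·,x))(s) + Σ_{y∈X} γ(s,y)·[𝔣(s,y) − 𝔣(s,x)]. Then for every λ > 0 and every bounded 𝔤 : S × X → ℝ there exists a unique bounded 𝔣 : S × X → ℝ with λ·𝔣(s,x) − (𝓛_Z 𝔣)(s,x) = 𝔤(s,x) for all (s,x) ∈ S × X, and this solution satisfies sup_{(s,x)} |𝔣(s,x)| ≤ (sup_{(s,x)} |𝔤(s,x)|)/λ. -/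
open Filter Topology

/-- The generator `𝓛_Z` of the limiting hidden Markov model on `S × X`:
`(𝓛_Z 𝔣)(s,x) = (𝓛 𝔣(·,x))(s) + Σ'_y γ(s,y)·[𝔣(s,y) − 𝔣(s,x)]`. -/
noncomputable def hmmGen {S X : Type*} [Fintype S] (r : S → S → ℝ) (γ : S → X → ℝ)
    (f : S → X → ℝ) (s : S) (x : X) : ℝ :=
  finGen r (fun t => f t x) s + ∑' y, γ s y * (f s y - f s x)

/-- A map on real functions that contracts uniform distances between bounded functions and
preserves boundedness has a unique bounded fixed point. -/
theorem exists_unique_bounded_fixedPoint {α : Type*} (T : (α → ℝ) → α → ℝ) (q : ℝ)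
    (hq0 : 0 ≤ q) (hq1 : q < 1)
    (hbdd : ∀ f : α → ℝ, (∃ C, ∀ a, |f a| ≤ C) → ∃ C, ∀ a, |T f a| ≤ C)
    (hT : ∀ f g : α → ℝ, (∃ C, ∀ a, |f a| ≤ C) → (∃ C, ∀ a, |g a| ≤ C) →
      ∀ D, (∀ a, |f a - g a| ≤ D) → ∀ a, |T f a - T g a| ≤ q * D) :
    ∃ f : α → ℝ, (∃ C, ∀ a, |f a| ≤ C) ∧ T f = f ∧
      ∀ g : α → ℝ, (∃ C, ∀ a, |g a| ≤ C) → T g = g → g = f := by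
  let : TopologicalSpace α := ⊥
  have : DiscreteTopology α := ⟨rfl⟩
  have hb (f : BoundedContinuousFunction α ℝ) : ∃ C, ∀ a, |f a| ≤ C :=
    ⟨‖f‖, fun a => f.norm_coe_le_norm a⟩
  choose B hB using fun f : BoundedContinuousFunction α ℝ => hbdd f (hb f)
  let U : BoundedContinuousFunction α ℝ → BoundedContinuousFunction α ℝ := fun f =>
    BoundedContinuousFunction.ofNormedAddCommGroupDiscrete (T f) (B f) (hB f)
  have hU : ContractingWith ⟨q, hq0⟩ U := by
    refine ⟨hq1, LipschitzWith.of_dist_le_mul fun f g => ?_⟩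
    refine (BoundedContinuousFunction.dist_le (mul_nonneg hq0 dist_nonneg)).2 fun a => ?_
    exact hT f g (hb f) (hb g) (dist f g) (fun a => f.dist_coe_le_dist (g := g) a) a
  refine ⟨hU.fixedPoint, hb _, congrArg DFunLike.coe hU.fixedPoint_isFixedPt, ?_⟩
  rintro g ⟨C, hC⟩ hg
  let g' := BoundedContinuousFunction.ofNormedAddCommGroupDiscrete g C hC
  have hg' : Function.IsFixedPt U g' := DFunLike.coe_injective hg
  exact congrArg DFunLike.coe (hU.fixedPoint_unique hg')

theorem Summable.mul_of_abs_le {X : Type*} {w f : X → ℝ} {C : ℝ} (hw : Summable w)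
    (hw0 : ∀ y, 0 ≤ w y) (hf : ∀ y, |f y| ≤ C) : Summable fun y => w y * f y := by
  refine Summable.of_norm_bounded (hw.mul_right C) fun y => ?_
  rw [Real.norm_eq_abs, abs_mul, abs_of_nonneg (hw0 y)]
  exact mul_le_mul_of_nonneg_left (hf y) (hw0 y)

theorem abs_tsum_mul_le_s6 {X : Type*} {w f : X → ℝ} {C : ℝ} (hw : Summable w)
    (hw0 : ∀ y, 0 ≤ w y) (hf : ∀ y, |f y| ≤ C) :
    |∑' y, w y * f y| ≤ (∑' y, w y) * C := by
  rw [← tsum_mul_right, ← Real.norm_eq_abs]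
  refine tsum_of_norm_bounded (hw.mul_right C).hasSum fun y => ?_
  rw [Real.norm_eq_abs, abs_mul, abs_of_nonneg (hw0 y)]
  exact mul_le_mul_of_nonneg_left (hf y) (hw0 y)

section Generator

variable {S X : Type*} [Fintype S] {r : S → S → ℝ} {γ : S → X → ℝ}

/-- The generator split into incoming averages and the total jump rate. -/
theorem hmmGen_eq (hγ0 : ∀ s y, 0 ≤ γ s y) (hγsum : ∀ s, Summable (γ s))
    {f : S → X → ℝ} {C : ℝ} (hf : ∀ s x, |f s x| ≤ C) (s : S) (x : X) :
    hmmGen r γ f s x = ∑ t, r s t * f t x + ∑' y, γ s y * f s y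
      - (∑ t, r s t + ∑' y, γ s y) * f s x := by
  simp only [hmmGen, finGen, mul_sub]
  rw [((hγsum s).mul_of_abs_le (hγ0 s) (hf s)).tsum_sub ((hγsum s).mul_right _),
    Finset.sum_sub_distrib, tsum_mul_right, ← Finset.sum_mul]
  ring

theorem hmmGen_sub (hγ0 : ∀ s y, 0 ≤ γ s y) (hγsum : ∀ s, Summable (γ s))
    {f g : S → X → ℝ} {C D : ℝ} (hf : ∀ s x, |f s x| ≤ C) (hg : ∀ s x, |g s x| ≤ D)
    (s : S) (x : X) :
    hmmGen r γ (fun t y => f t y - g t y) s x = hmmGen r γ f s x - hmmGen r γ g s x := by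
  have hfg : ∀ t y, |f t y - g t y| ≤ C + D := fun t y =>
    (abs_sub _ _).trans (add_le_add (hf t y) (hg t y))
  rw [hmmGen_eq hγ0 hγsum hf, hmmGen_eq hγ0 hγsum hg, hmmGen_eq hγ0 hγsum hfg]
  simp only [mul_sub]
  rw [((hγsum s).mul_of_abs_le (hγ0 s) (hf s)).tsum_sub
    ((hγsum s).mul_of_abs_le (hγ0 s) (hg s)), Finset.sum_sub_distrib]
  ring

/-- If `M` dominates all total jump rates, then `𝓛_Z + M` has sup-norm at most `M`. -/
theorem abs_hmmGen_add_le (hr : ∀ s t, 0 ≤ r s t) (hγ0 : ∀ s y, 0 ≤ γ s y)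
    (hγsum : ∀ s, Summable (γ s)) {M : ℝ} (hM : ∀ s, ∑ t, r s t + ∑' y, γ s y ≤ M)
    {f : S → X → ℝ} {C : ℝ} (hf : ∀ s x, |f s x| ≤ C) (s : S) (x : X) :
    |hmmGen r γ f s x + M * f s x| ≤ M * C := by
  have h1 : |∑ t, r s t * f t x| ≤ (∑ t, r s t) * C := by
    rw [Finset.sum_mul]
    refine (Finset.abs_sum_le_sum_abs _ _).trans (Finset.sum_le_sum fun t _ => ?_)
    rw [abs_mul, abs_of_nonneg (hr s t)]
    exact mul_le_mul_of_nonneg_left (hf t x) (hr s t)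
  have h2 := abs_tsum_mul_le_s6 (hγsum s) (hγ0 s) (hf s)
  have h3 : |(M - (∑ t, r s t + ∑' y, γ s y)) * f s x|
      ≤ (M - (∑ t, r s t + ∑' y, γ s y)) * C := by
    rw [abs_mul, abs_of_nonneg (sub_nonneg.2 (hM s))]
    exact mul_le_mul_of_nonneg_left (hf s x) (sub_nonneg.2 (hM s))
  rw [hmmGen_eq hγ0 hγsum hf]
  calc _ = |∑ t, r s t * f t x + ∑' y, γ s y * f s y
        + (M - (∑ t, r s t + ∑' y, γ s y)) * f s x| := by congr 1; ring
    _ ≤ _ := abs_add_three _ _ _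
    _ ≤ _ := add_le_add (add_le_add h1 h2) h3
    _ = M * C := by ring

end Generator

/-- Unique solvability of the reduced resolvent equation `(λ − 𝓛_Z)𝔣 = 𝔤` for the
limiting hidden Markov model generator, together with the bound
`sup |𝔣| ≤ sup |𝔤| / λ`. -/
theorem hmm_resolvent_exists_unique
    (S : Type*) [Fintype S] [Nonempty S]
    (X : Type*) [Countable X] [Nonempty X]
    (r : S → S → ℝ) (hr : ∀ s t, 0 ≤ r s t)
    (γ : S → X → ℝ) (hγ0 : ∀ s y, 0 ≤ γ s y)
    (hγsum : ∀ s, Summable (γ s))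
    (lam : ℝ) (hlam : 0 < lam)
    (𝔤 : S → X → ℝ) (h𝔤 : ∃ C : ℝ, ∀ s x, |𝔤 s x| ≤ C) :
    ∃ 𝔣 : S → X → ℝ,
      (∃ C : ℝ, ∀ s x, |𝔣 s x| ≤ C) ∧
      (∀ s x, lam * 𝔣 s x - hmmGen r γ 𝔣 s x = 𝔤 s x) ∧
      (⨆ p : S × X, |𝔣 p.1 p.2|) ≤ (⨆ p : S × X, |𝔤 p.1 p.2|) / lam ∧
      (∀ 𝔣' : S → X → ℝ, (∃ C : ℝ, ∀ s x, |𝔣' s x| ≤ C) →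
        (∀ s x, lam * 𝔣' s x - hmmGen r γ 𝔣' s x = 𝔤 s x) → 𝔣' = 𝔣) := by
  have hrate (s : S) : 0 ≤ ∑ t, r s t + ∑' y, γ s y :=
    add_nonneg (Finset.sum_nonneg fun t _ => hr s t) (tsum_nonneg (hγ0 s))
  obtain ⟨M, hM0, hM⟩ : ∃ M : ℝ, 0 ≤ M ∧ ∀ s, ∑ t, r s t + ∑' y, γ s y ≤ M :=
    ⟨∑ s, (∑ t, r s t + ∑' y, γ s y), Finset.sum_nonneg fun s _ => hrate s, fun s =>
      Finset.single_le_sum (f := fun s => ∑ t, r s t + ∑' y, γ s y)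
        (fun s _ => hrate s) (Finset.mem_univ s)⟩
  have hpos : 0 < lam + M := by linarith
  obtain ⟨G, hG⟩ := h𝔤
  let T : (S × X → ℝ) → S × X → ℝ := fun f p =>
    (𝔤 p.1 p.2 + (hmmGen r γ (Function.curry f) p.1 p.2 + M * f p)) / (lam + M)
  have hTbdd {f : S × X → ℝ} {A C : ℝ} (hA : ∀ s x, |𝔤 s x| ≤ A) (hC : ∀ p, |f p| ≤ C)
      (p : S × X) : |T f p| ≤ (A + M * C) / (lam + M) := by
    rw [abs_div, abs_of_pos hpos]
    gcongr
    exact (abs_add_le _ _).trans (add_le_add (hA _ _)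
      (abs_hmmGen_add_le hr hγ0 hγsum hM (f := Function.curry f) (fun s x => hC (s, x)) p.1 p.2))
  have hTfix (f : S × X → ℝ) : T f = f ↔
      ∀ s x, lam * f (s, x) - hmmGen r γ (Function.curry f) s x = 𝔤 s x := by
    rw [funext_iff, Prod.forall]
    refine forall₂_congr fun s x => ?_
    rw [div_eq_iff hpos.ne']
    constructor <;> intro h <;> linarith
  obtain ⟨f, ⟨C, hC⟩, hfix, huniq⟩ := exists_unique_bounded_fixedPoint T (M / (lam + M))
    (by positivity) ((div_lt_one hpos).2 (by linarith))
    (fun f ⟨C, hC⟩ => ⟨_, hTbdd hG hC⟩) (by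
      rintro f g ⟨A, hA⟩ ⟨B, hB⟩ D hD p
      have key := abs_hmmGen_add_le hr hγ0 hγsum hM
        (f := fun s x => Function.curry f s x - Function.curry g s x)
        (fun s x => hD (s, x)) p.1 p.2
      rw [hmmGen_sub (f := Function.curry f) (g := Function.curry g) hγ0 hγsum
        (fun s x => hA (s, x)) (fun s x => hB (s, x))] at key
      rw [← sub_div, abs_div, abs_of_pos hpos, div_mul_eq_mul_div]
      gcongr
      refine le_of_eq_of_le (congrArg abs ?_) key
      simp only [Function.curry]
      ring)
  refine ⟨Function.curry f, ⟨C, fun s x => hC (s, x)⟩, (hTfix f).1 hfix, ?_, ?_⟩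
  · have hgb : BddAbove (Set.range fun p : S × X => |𝔤 p.1 p.2|) :=
      ⟨G, by rintro _ ⟨p, rfl⟩; exact hG _ _⟩
    have hfb : BddAbove (Set.range fun p : S × X => |f p|) :=
      ⟨C, by rintro _ ⟨p, rfl⟩; exact hC _⟩
    have hsup : (⨆ p, |f p|) ≤ ((⨆ p : S × X, |𝔤 p.1 p.2|) + M * ⨆ p, |f p|) / (lam + M) := by
      refine ciSup_le fun p => ?_
      rw [← congrFun hfix p]
      exact hTbdd (fun s x => le_ciSup hgb (s, x)) (le_ciSup hfb) p
    rw [le_div_iff₀ hpos] at hsup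
    rw [le_div_iff₀ hlam]
    simp only [Function.curry_apply]
    linarith
  · rintro h ⟨D, hD⟩ heq
    exact congrArg Function.curry
      (huniq (Function.uncurry h) ⟨D, fun p => hD p.1 p.2⟩ ((hTfix _).2 heq))
end
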